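/- If p + q = n, then for each i ≥ 0 the multiplication map by g^{2i} from D^{p−i,q−i} to D^{p+i,q+i} is a linear isomorphism. -/

import Mathlib

open scoped BigOperators

namespace DoubleForm

/-- The model Euclidean vector space of dimension `n` (with the standard inner product). -/
abbrev V (n : ℕ) := Fin n → ℝ

/-- The standard orthonormal basis of `V n`. -/
def E (n : ℕ) (j : Fin n) : V n := fun k => if k = j then 1 else 0

/-- Raw double forms of bidegree `(p,q)`: real valued functions of `p` vectors and `q` vectors.
Genuine double forms are singled out by `IsDF`. -/
abbrev DF (n p q : ℕ) := (Fin p → V n) → (Fin q → V n) → ℝ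

/-- `ω` is a genuine double form: multilinear and alternating in the first `p`
and in the last `q` arguments. -/
def IsDF {n p q : ℕ} (ω : DF n p q) : Prop :=
  ∃ F : AlternatingMap ℝ (V n) (AlternatingMap ℝ (V n) ℝ (Fin q)) (Fin p),
    ∀ x y, ω x y = F x y

/-- Transport of double forms along equalities of the degrees. -/
def DFcast {n p q p' q' : ℕ} (h1 : p = p') (h2 : q = q') (ω : DF n p q) : DF n p' q' :=
  fun x y => ω (fun i => x (Fin.cast h1 i)) (fun j => y (Fin.cast h2 j))

/-- The product of double forms (Kulkarni's product). -/
noncomputable def mul {n p q r s : ℕ} (ω : DF n p q) (η : DF n r s) :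
    DF n (p + r) (q + s) := fun x y =>
  (((p.factorial * r.factorial * q.factorial * s.factorial : ℕ) : ℝ))⁻¹ *
    ∑ σ : Equiv.Perm (Fin (p + r)), ∑ ρ : Equiv.Perm (Fin (q + s)),
      ((Equiv.Perm.sign σ : ℤ) : ℝ) * ((Equiv.Perm.sign ρ : ℤ) : ℝ) *
        ω (fun i => x (σ (Fin.castAdd r i))) (fun j => y (ρ (Fin.castAdd s j))) *
        η (fun i => x (σ (Fin.natAdd p i))) (fun j => y (ρ (Fin.natAdd q j)))

/-- The metric `g` as a double form of bidegree `(1,1)`. -/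
noncomputable def gm (n : ℕ) : DF n 1 1 := fun x y => ∑ j : Fin n, x 0 j * y 0 j

/-- Powers `g^l` of the metric in the algebra of double forms. -/
noncomputable def gpow (n : ℕ) : (l : ℕ) → DF n l l
  | 0 => fun _ _ => 1
  | l + 1 => mul (gpow n l) (gm n)

/-- The contraction map `c : D^{p,q} → D^{p-1,q-1}` (zero if `p = 0` or `q = 0`). -/
noncomputable def contr {n : ℕ} : ∀ {p q : ℕ}, DF n p q → DF n (p - 1) (q - 1)
  | p + 1, q + 1, ω => fun x y =>
      ∑ j : Fin n, ω (Fin.cons (E n j) x) (Fin.cons (E n j) y)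
  | 0, _, _ => 0
  | _ + 1, 0, _ => 0

/-- Iterated contraction `c^k`. -/
noncomputable def ck {n : ℕ} : ∀ (k : ℕ) {p q : ℕ}, DF n p q → DF n (p - k) (q - k)
  | 0, _, _, ω => ω
  | k + 1, _, _, ω => contr (ck k ω)

/-- The natural inner product on `D^{p,q}`. -/
noncomputable def innerDF {n p q : ℕ} (ω θ : DF n p q) : ℝ :=
  (((p.factorial * q.factorial : ℕ) : ℝ))⁻¹ *
    ∑ f : Fin p → Fin n, ∑ g : Fin q → Fin n,
      ω (fun i => E n (f i)) (fun j => E n (g j)) *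
        θ (fun i => E n (f i)) (fun j => E n (g j))

/-- The natural inner product extended to all bidegrees: distinct bidegrees are orthogonal. -/
noncomputable def innerDF2 {n p q r s : ℕ} (ω : DF n p q) (θ : DF n r s) : ℝ :=
  if h : p = r ∧ q = s then innerDF (DFcast h.1 h.2 ω) θ else 0

/-- Determinant of the `n × n` matrix whose first `p` rows are the basis vectors `E (f i)`
and whose remaining rows are the vectors `x`. -/
noncomputable def rowsDet {n : ℕ} (p : ℕ) (f : Fin p → Fin n) (x : Fin (n - p) → V n) : ℝ :=
  Matrix.det (Matrix.of fun i k : Fin n =>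
    if h : (i : ℕ) < p then E n (f ⟨(i : ℕ), h⟩) k
    else x ⟨(i : ℕ) - p, by have := i.isLt; omega⟩ k)

/-- The Hodge star operator extended to double forms, `D^{p,q} → D^{n-p,n-q}`. -/
noncomputable def hstar {n p q : ℕ} (ω : DF n p q) : DF n (n - p) (n - q) := fun x y =>
  (((p.factorial * q.factorial : ℕ) : ℝ))⁻¹ *
    ∑ f : Fin p → Fin n, ∑ g : Fin q → Fin n,
      ω (fun i => E n (f i)) (fun j => E n (g j)) * rowsDet p f x * rowsDet q g y

/-- The first Bianchi sum `B : D^{p,q} → D^{p+1,q-1}` (zero if `q = 0`). -/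
noncomputable def bianchi {n : ℕ} : ∀ {p q : ℕ}, DF n p q → DF n (p + 1) (q - 1)
  | p, q + 1, ω => fun x y =>
      ∑ j : Fin (p + 1), (-1 : ℝ) ^ ((j : ℕ) + 1) *
        ω (fun i => x (j.succAbove i)) (Fin.cons (x j) y)
  | _, 0, _ => 0

/-- Symmetric double forms of bidegree `(p,p)`. -/
def IsSymm {n p : ℕ} (ω : DF n p p) : Prop := ∀ x y, ω x y = ω y x

/-- The total (bigraded) space of double forms. -/
abbrev DT (n : ℕ) := ∀ p q : ℕ, DF n p q

/-- Embedding of the component `D^{p,q}` into the total space. -/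
noncomputable def emb {n : ℕ} (p q : ℕ) (ω : DF n p q) : DT n := fun p' q' =>
  if h : p = p' ∧ q = q' then DFcast h.1 h.2 ω else 0


/-- If `f v` and `e v` satisfy the commutation relations of `sl₂` with `h`, then a vector of weight
`w` on which `f` is nilpotent is not killed by any power of `e` of exponent at most `w`. -/
theorem sl2_pow_injective {M : Type*} [AddCommGroup M] [Module ℝ M] (e f h : M →ₗ[ℝ] M)
    (hfe : ∀ v, f (e v) = e (f v) + h v) (hhe : ∀ v, h (e v) + (2 : ℝ) • e v = e (h v))
    (hhf : ∀ v, h (f v) = f (h v) + (2 : ℝ) • f v) (m : ℕ) :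
    ∀ (v : M) (w : ℝ) (k : ℕ), h v = w • v → (f ^ m) v = 0 → (k : ℝ) ≤ w → (e ^ k) v = 0 →
      v = 0 := by
  have weight_pow : ∀ (v : M) (w : ℝ), h v = w • v → ∀ k : ℕ,
      h ((e ^ k) v) = (w - 2 * k) • (e ^ k) v := by
    intro v w hv k
    induction k with
    | zero => simp [hv]
    | succ k ih =>
      rw [pow_succ', Module.End.mul_apply, eq_sub_of_add_eq (hhe _), ih, map_smul]
      push_cast
      module
  have comm_pow : ∀ (v : M) (w : ℝ), h v = w • v → ∀ k : ℕ,
      f ((e ^ (k + 1)) v) = (e ^ (k + 1)) (f v) + ((k + 1) * (w - k)) • (e ^ k) v := by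
    intro v w hv k
    induction k with
    | zero => simp [hfe, hv]
    | succ k ih =>
      rw [pow_succ' e (k + 1), Module.End.mul_apply, hfe, ih, weight_pow v w hv, map_add, map_smul,
        Module.End.mul_apply, pow_succ' e k, Module.End.mul_apply]
      push_cast
      module
  induction m with
  | zero => intro v w k _ hv _ _; simpa using hv
  | succ m ih =>
    intro v w k hv hf hk hek
    induction k with
    | zero => simpa using hek
    | succ k ihk =>
      have hc := comm_pow v w hv k
      push_cast at hk
      have hfv : f v = 0 := by
        refine ih (f v) (w + 2) (k + 2) (by rw [hhf, hv, map_smul]; module)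
          (by rwa [pow_succ, Module.End.mul_apply] at hf) (by push_cast; linarith) ?_
        have h2 := congrArg e hc
        rw [hek, map_zero, map_zero, map_add, map_smul, ← Module.End.mul_apply, ← pow_succ',
          ← Module.End.mul_apply e, ← pow_succ', hek, smul_zero, add_zero] at h2
        exact h2.symm
      rw [hek, hfv, map_zero, map_zero, zero_add] at hc
      refine ihk (by linarith) ((smul_eq_zero.1 hc.symm).resolve_left ?_)
      have : (0 : ℝ) < w - k := by linarith
      positivity

theorem alternatingMap_sum_apply {ι κ M N : Type*} [AddCommGroup M] [Module ℝ M]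
    [AddCommGroup N] [Module ℝ N] (s : Finset ι) (F : ι → M [⋀^κ]→ₗ[ℝ] N) (x : κ → M) :
    (∑ i ∈ s, F i) x = ∑ i ∈ s, F i x := by
  classical
  induction s using Finset.induction_on with
  | empty => simp
  | insert i s hi ih => simp [Finset.sum_insert hi, ih]

/-- Double forms of bidegree `(p,q)` as alternating maps with values in alternating maps. -/
abbrev AltForm (n p q : ℕ) := V n [⋀^Fin p]→ₗ[ℝ] (V n [⋀^Fin q]→ₗ[ℝ] ℝ)

/-- Exterior multiplication of a form by the covector dual to a vector. -/
noncomputable def covecWedge (n q : ℕ) :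
    V n →ₗ[ℝ] (V n [⋀^Fin q]→ₗ[ℝ] ℝ) →ₗ[ℝ] (V n [⋀^Fin (q + 1)]→ₗ[ℝ] ℝ) :=
  LinearMap.mk₂ ℝ
    (fun x G => AlternatingMap.alternatizeUncurryFin ((dotProductBilin ℝ ℝ x).smulRight G))
    (fun x x' G => by
      ext y; simp [AlternatingMap.alternatizeUncurryFin_apply, add_mul,
        Finset.sum_add_distrib])
    (fun r x G => by
      ext y; simp [AlternatingMap.alternatizeUncurryFin_apply, Finset.mul_sum, mul_assoc,
        mul_left_comm])
    (fun x G G' => by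
      ext y; simp [AlternatingMap.alternatizeUncurryFin_apply, Finset.sum_add_distrib])
    (fun r x G => by
      ext y; simp [AlternatingMap.alternatizeUncurryFin_apply, Finset.mul_sum, mul_left_comm])

theorem covecWedge_apply {n q : ℕ} (x : V n) (G : V n [⋀^Fin q]→ₗ[ℝ] ℝ) (y : Fin (q + 1) → V n) :
    covecWedge n q x G y =
      ∑ b : Fin (q + 1), (-1 : ℝ) ^ (b : ℕ) * ((x ⬝ᵥ y b) * G (b.removeNth y)) := by
  simp [covecWedge, AlternatingMap.alternatizeUncurryFin_apply]

/-- The product of the metric with a double form, expanded along the arguments of the metric. -/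
noncomputable def metricMulForm {n p q : ℕ} (F : AltForm n p q) : AltForm n (p + 1) (q + 1) :=
  AlternatingMap.alternatizeUncurryFin
    { toFun := fun x => (covecWedge n q x).compAlternatingMap F
      map_add' := fun x x' => by ext; simp
      map_smul' := fun r x => by ext; simp }

theorem metricMulForm_apply {n p q : ℕ} (F : AltForm n p q) (x : Fin (p + 1) → V n)
    (y : Fin (q + 1) → V n) :
    metricMulForm F x y = ∑ a : Fin (p + 1), ∑ b : Fin (q + 1), (-1 : ℝ) ^ (a : ℕ) *
      ((-1 : ℝ) ^ (b : ℕ) * ((x a ⬝ᵥ y b) * F (a.removeNth x) (b.removeNth y))) := by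
  rw [metricMulForm, AlternatingMap.alternatizeUncurryFin_apply, alternatingMap_sum_apply]
  refine Finset.sum_congr rfl fun a _ => ?_
  rw [← Finset.mul_sum, ← covecWedge_apply]
  rw [AlternatingMap.smul_apply, zsmul_eq_mul]
  simp

/-- Multiplication by the metric as a linear map. -/
noncomputable def metricMul (n p q : ℕ) : AltForm n p q →ₗ[ℝ] AltForm n (p + 1) (q + 1) where
  toFun := metricMulForm
  map_add' F G := by
    ext x y
    simp [metricMulForm_apply, mul_add, Finset.sum_add_distrib]
  map_smul' r F := by
    ext x y
    simp [metricMulForm_apply, Finset.mul_sum, mul_left_comm]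

theorem metricMul_apply {n p q : ℕ} (F : AltForm n p q) (x : Fin (p + 1) → V n)
    (y : Fin (q + 1) → V n) :
    metricMul n p q F x y = ∑ a : Fin (p + 1), ∑ b : Fin (q + 1), (-1 : ℝ) ^ (a : ℕ) *
      ((-1 : ℝ) ^ (b : ℕ) * ((x a ⬝ᵥ y b) * F (a.removeNth x) (b.removeNth y))) :=
  metricMulForm_apply F x y

/-- Contraction of the first arguments as a linear map. -/
noncomputable def contraction (n p q : ℕ) : AltForm n (p + 1) (q + 1) →ₗ[ℝ] AltForm n p q where
  toFun F := ∑ j : Fin n,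
    (AlternatingMap.curryLeftLinearMap.flip (E n j)).compAlternatingMap (F.curryLeft (E n j))
  map_add' F G := by
    ext x y
    simp [alternatingMap_sum_apply, Finset.sum_add_distrib]
  map_smul' r F := by
    ext x y
    simp [alternatingMap_sum_apply, Finset.mul_sum]

theorem contraction_apply {n p q : ℕ} (F : AltForm n (p + 1) (q + 1)) (x : Fin p → V n)
    (y : Fin q → V n) :
    contraction n p q F x y =
      ∑ j : Fin n, F (Matrix.vecCons (E n j) x) (Matrix.vecCons (E n j) y) := by
  simp [contraction, alternatingMap_sum_apply]

theorem removeNth_succ_vecCons {α : Type*} {k : ℕ} (z : α) (x : Fin (k + 1) → α)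
    (a : Fin (k + 1)) :
    a.succ.removeNth (Matrix.vecCons z x) = Matrix.vecCons z (a.removeNth x) :=
  Fin.cons_comp_succ_succAbove _ _ _

theorem vecCons_removeNth {q : ℕ} {M : Type*} [AddCommGroup M] [Module ℝ M] {N : Type*}
    [AddCommGroup N] [Module ℝ N] (G : M [⋀^Fin (q + 1)]→ₗ[ℝ] N) (y : Fin (q + 1) → M)
    (b : Fin (q + 1)) :
    G (Matrix.vecCons (y b) (b.removeNth y)) = (-1 : ℤ) ^ (b : ℕ) • G y := by
  rw [← AlternatingMap.neg_one_pow_smul_map_insertNth, Fin.insertNth_self_removeNth]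

theorem sum_E_dotProduct_smul {n : ℕ} (v : V n) : ∑ j, (E n j ⬝ᵥ v) • E n j = v := by
  ext k
  simp [E, dotProduct]

theorem E_dotProduct_self {n : ℕ} (j : Fin n) : E n j ⬝ᵥ E n j = 1 := by
  simp [E, dotProduct]

theorem sum_dotProduct_mul_vecCons {n q : ℕ} (G : V n [⋀^Fin (q + 1)]→ₗ[ℝ] ℝ) (v : V n)
    (y : Fin q → V n) :
    ∑ j, (E n j ⬝ᵥ v) * G (Matrix.vecCons (E n j) y) = G (Matrix.vecCons v y) := by
  conv_rhs => rw [← sum_E_dotProduct_smul v]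
  simp [← AlternatingMap.curryLeft_apply_apply, alternatingMap_sum_apply]

theorem neg_one_pow_mul_self (a : ℕ) : (-1 : ℝ) ^ a * (-1) ^ a = 1 := by
  rw [← mul_pow]; simp

theorem sum_removeNth_succ_vecCons {n q : ℕ} (G : V n [⋀^Fin q]→ₗ[ℝ] ℝ) (y : Fin q → V n) :
    ∑ j : Fin n, ∑ b : Fin q, (-1 : ℝ) ^ ((b : ℕ) + 1) *
      ((E n j ⬝ᵥ y b) * G (b.succ.removeNth (Matrix.vecCons (E n j) y))) = -(q : ℝ) * G y := by
  rw [Finset.sum_comm]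
  cases q with
  | zero => simp
  | succ q =>
    have h : ∀ b : Fin (q + 1), ∑ j : Fin n, (-1 : ℝ) ^ ((b : ℕ) + 1) *
        ((E n j ⬝ᵥ y b) * G (b.succ.removeNth (Matrix.vecCons (E n j) y))) = - G y := by
      intro b
      simp_rw [removeNth_succ_vecCons, ← Finset.mul_sum]
      rw [sum_dotProduct_mul_vecCons, vecCons_removeNth, zsmul_eq_mul]
      push_cast
      rw [pow_succ, ← mul_assoc, mul_right_comm _ (-1), neg_one_pow_mul_self]
      ring
    simp only [h, Finset.sum_const, Finset.card_univ, Fintype.card_fin, nsmul_eq_mul]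
    ring

theorem contraction_metricMul_apply {n p q : ℕ} (F : AltForm n p q) (x : Fin p → V n)
    (y : Fin q → V n) :
    contraction n p q (metricMul n p q F) x y = ((n : ℝ) - p - q) * F x y +
      ∑ j : Fin n, ∑ a : Fin p, ∑ b : Fin q, (-1 : ℝ) ^ (a : ℕ) * ((-1 : ℝ) ^ (b : ℕ) *
        ((x a ⬝ᵥ y b) * F (a.succ.removeNth (Matrix.vecCons (E n j) x))
          (b.succ.removeNth (Matrix.vecCons (E n j) y)))) := by
  have hx := sum_removeNth_succ_vecCons
    ((LinearMap.mk ⟨fun G : V n [⋀^Fin q]→ₗ[ℝ] ℝ => G y, fun _ _ => rfl⟩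
      fun _ _ => rfl).compAlternatingMap F) x
  have hy := sum_removeNth_succ_vecCons (F x) y
  simp only [LinearMap.compAlternatingMap_apply, LinearMap.coe_mk, AddHom.coe_mk] at hx
  have h0 : ∀ {k : ℕ} (z : V n) (v : Fin k → V n),
      Fin.removeNth 0 (Matrix.vecCons z v) = v := fun z v => rfl
  rw [contraction_apply]
  simp only [metricMul_apply, Fin.sum_univ_succ, Finset.sum_add_distrib, h0,
    Matrix.cons_val_zero, Matrix.cons_val_succ, E_dotProduct_self, Fin.val_zero, Fin.val_succ,
    pow_zero, one_mul]
  rw [hy]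
  simp only [dotProduct_comm (x _) (E n _), hx]
  simp only [pow_succ, Finset.sum_const, Finset.card_univ, Fintype.card_fin, nsmul_eq_mul,
    mul_neg, mul_one, neg_mul, neg_neg]
  ring

theorem contraction_metricMul_succ {n p q : ℕ} (F : AltForm n (p + 1) (q + 1)) :
    contraction n (p + 1) (q + 1) (metricMul n (p + 1) (q + 1) F) =
      metricMul n p q (contraction n p q F) + ((n : ℝ) - (p + 1) - (q + 1)) • F := by
  ext x y
  rw [contraction_metricMul_apply, add_comm, AlternatingMap.add_apply, AlternatingMap.add_apply,
    metricMul_apply]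
  simp only [contraction_apply, removeNth_succ_vecCons, Finset.mul_sum]
  rw [Finset.sum_comm]
  congr 1
  · exact Finset.sum_congr rfl fun a _ => Finset.sum_comm
  · simp

theorem contraction_metricMul_of_eq_zero {n p q : ℕ} (h : p = 0 ∨ q = 0) (F : AltForm n p q) :
    contraction n p q (metricMul n p q F) = ((n : ℝ) - p - q) • F := by
  ext x y
  rw [contraction_metricMul_apply]
  rcases h with rfl | rfl <;> simp

/-- Families of double forms, one of each bidegree. -/
def AltFamily (n : ℕ) := ∀ p q : ℕ, AltForm n p q

noncomputable instance (n : ℕ) : AddCommGroup (AltFamily n) :=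
  inferInstanceAs (AddCommGroup (∀ p q : ℕ, AltForm n p q))

noncomputable instance (n : ℕ) : Module ℝ (AltFamily n) :=
  inferInstanceAs (Module ℝ (∀ p q : ℕ, AltForm n p q))

namespace AltFamily

theorem add_apply {n : ℕ} (m m' : AltFamily n) (p q : ℕ) : (m + m') p q = m p q + m' p q := rfl

theorem smul_apply {n : ℕ} (r : ℝ) (m : AltFamily n) (p q : ℕ) : (r • m) p q = r • m p q := rfl

end AltFamily

/-- Multiplication of a family of double forms by the metric. -/
noncomputable def raise (n : ℕ) : AltFamily n →ₗ[ℝ] AltFamily n where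
  toFun m
    | p + 1, q + 1 => metricMul n p q (m p q)
    | 0, _ => 0
    | _ + 1, 0 => 0
  map_add' m m' := by
    funext p q
    rcases p with _ | p
    · exact (add_zero 0).symm
    rcases q with _ | q
    · exact (add_zero 0).symm
    exact map_add (metricMul n p q) (m p q) (m' p q)
  map_smul' r m := by
    funext p q
    rcases p with _ | p
    · exact (smul_zero r).symm
    rcases q with _ | q
    · exact (smul_zero r).symm
    exact map_smul (metricMul n p q) r (m p q)

/-- Contraction of a family of double forms. -/
noncomputable def lower (n : ℕ) : AltFamily n →ₗ[ℝ] AltFamily n where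
  toFun m p q := contraction n p q (m (p + 1) (q + 1))
  map_add' m m' := by
    funext p q
    exact map_add (contraction n p q) (m (p + 1) (q + 1)) (m' (p + 1) (q + 1))
  map_smul' r m := by
    funext p q
    exact map_smul (contraction n p q) r (m (p + 1) (q + 1))

/-- The operator multiplying double forms of bidegree `(p,q)` by `n - p - q`. -/
noncomputable def weight (n : ℕ) : AltFamily n →ₗ[ℝ] AltFamily n where
  toFun m p q := ((n : ℝ) - p - q) • m p q
  map_add' m m' := by
    funext p q
    exact smul_add _ (m p q) (m' p q)
  map_smul' r m := by
    funext p q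
    exact smul_comm _ r (m p q)

theorem raise_succ_succ {n : ℕ} (m : AltFamily n) (p q : ℕ) :
    raise n m (p + 1) (q + 1) = metricMul n p q (m p q) := rfl

theorem raise_zero_left {n : ℕ} (m : AltFamily n) (q : ℕ) : raise n m 0 q = 0 := by
  cases q <;> rfl

theorem raise_zero_right {n : ℕ} (m : AltFamily n) (p : ℕ) : raise n m p 0 = 0 := by
  cases p <;> rfl

theorem lower_apply {n : ℕ} (m : AltFamily n) (p q : ℕ) :
    lower n m p q = contraction n p q (m (p + 1) (q + 1)) := rfl

theorem weight_apply {n : ℕ} (m : AltFamily n) (p q : ℕ) :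
    weight n m p q = ((n : ℝ) - p - q) • m p q := rfl

theorem lower_raise {n : ℕ} (m : AltFamily n) :
    lower n (raise n m) = raise n (lower n m) + weight n m := by
  funext p q
  rw [AltFamily.add_apply, weight_apply, lower_apply, raise_succ_succ]
  rcases p with _ | p
  · rw [contraction_metricMul_of_eq_zero (.inl rfl), raise_zero_left, zero_add]
  rcases q with _ | q
  · rw [contraction_metricMul_of_eq_zero (.inr rfl), raise_zero_right, zero_add]
  rw [contraction_metricMul_succ, raise_succ_succ, lower_apply]
  push_cast
  rfl

theorem weight_raise {n : ℕ} (m : AltFamily n) :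
    weight n (raise n m) + (2 : ℝ) • raise n m = raise n (weight n m) := by
  funext p q
  rw [AltFamily.add_apply, AltFamily.smul_apply, weight_apply]
  rcases p with _ | p
  · simp [raise_zero_left]
  rcases q with _ | q
  · simp [raise_zero_right]
  rw [raise_succ_succ, raise_succ_succ, weight_apply, map_smul]
  push_cast
  module

theorem weight_lower {n : ℕ} (m : AltFamily n) :
    weight n (lower n m) = lower n (weight n m) + (2 : ℝ) • lower n m := by
  funext p q
  rw [AltFamily.add_apply, AltFamily.smul_apply, weight_apply, lower_apply,
    lower_apply, weight_apply, map_smul]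
  push_cast
  module

theorem altForm_eq_zero {n p q : ℕ} (h : n < p) (F : AltForm n p q) : F = 0 := by
  ext x : 1
  refine F.map_linearDependent x fun hx => ?_
  have := hx.fintype_card_le_finrank
  simp at this
  omega

theorem lower_pow_eq_zero {n : ℕ} (m : AltFamily n) : (lower n ^ (n + 1)) m = 0 := by
  have h : ∀ k p q : ℕ, n < p + k → (lower n ^ k) m p q = 0 := by
    intro k
    induction k with
    | zero => exact fun p q hp => altForm_eq_zero hp _
    | succ k ih =>
      intro p q hp
      rw [pow_succ', Module.End.mul_apply, lower_apply, ih _ _ (by omega), map_zero]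
  funext p q
  exact h _ _ _ (by omega)

theorem raise_pow_eq_zero {n : ℕ} (m : AltFamily n) : (raise n ^ (n + 1)) m = 0 := by
  have h : ∀ k p q : ℕ, p < k → (raise n ^ k) m p q = 0 := by
    intro k
    induction k with
    | zero => exact fun p q hp => absurd hp (by omega)
    | succ k ih =>
      intro p q hp
      rw [pow_succ', Module.End.mul_apply]
      rcases p with _ | p
      · exact raise_zero_left _ _
      rcases q with _ | q
      · exact raise_zero_right _ _
      rw [raise_succ_succ, ih _ _ (by omega), map_zero]
  funext p q
  rcases le_or_gt p n with hp | hp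
  · exact h _ _ _ (by omega)
  · exact altForm_eq_zero hp _

/-- The family whose only nonzero member is the given double form. -/
noncomputable def single (n p q : ℕ) : AltForm n p q →ₗ[ℝ] AltFamily n :=
  LinearMap.single ℝ (fun p => ∀ q, AltForm n p q) p ∘ₗ LinearMap.single ℝ (AltForm n p) q

theorem single_apply {n p q : ℕ} (F : AltForm n p q) (r s : ℕ) :
    single n p q F r s =
      (Pi.single p (Pi.single q F) : ∀ r s : ℕ, AltForm n r s) r s := rfl

theorem single_self {n p q : ℕ} (F : AltForm n p q) : single n p q F p q = F := by
  rw [single_apply, Pi.single_eq_same, Pi.single_eq_same]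

theorem single_of_ne {n p q r s : ℕ} (F : AltForm n p q) (h : ¬(r = p ∧ s = q)) :
    single n p q F r s = 0 := by
  rw [single_apply]
  by_cases hr : r = p
  · subst hr
    rw [Pi.single_eq_same, Pi.single_eq_of_ne fun hs => h ⟨rfl, hs⟩]
  · rw [Pi.single_eq_of_ne hr, Pi.zero_apply]

theorem weight_single {n p q : ℕ} (F : AltForm n p q) :
    weight n (single n p q F) = ((n : ℝ) - p - q) • single n p q F := by
  funext r s
  rw [weight_apply, AltFamily.smul_apply]
  by_cases h : r = p ∧ s = q
  · rw [h.1, h.2]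
  · simp [single_of_ne F h]

theorem raise_pow_single {n p q : ℕ} (F : AltForm n p q) (k : ℕ) :
    (raise n ^ k) (single n p q F) =
      single n (k + p) (k + q) ((raise n ^ k) (single n p q F) (k + p) (k + q)) := by
  have h : ∀ r s : ℕ, ¬(r = k + p ∧ s = k + q) → (raise n ^ k) (single n p q F) r s = 0 := by
    induction k with
    | zero => exact fun r s hrs => single_of_ne F (by simpa using hrs)
    | succ k ih =>
      intro r s hrs
      rw [pow_succ', Module.End.mul_apply]
      rcases r with _ | r
      · exact raise_zero_left _ _
      rcases s with _ | s
      · exact raise_zero_right _ _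
      rw [raise_succ_succ, ih _ _ (by omega), map_zero]
  funext r s
  by_cases hrs : r = k + p ∧ s = k + q
  · obtain ⟨rfl, rfl⟩ := hrs
    rw [single_self]
  · rw [h _ _ hrs, single_of_ne _ hrs]

theorem lower_pow_single {n p q : ℕ} (k : ℕ) (F : AltForm n (k + p) (k + q)) :
    (lower n ^ k) (single n (k + p) (k + q) F) =
      single n p q ((lower n ^ k) (single n (k + p) (k + q) F) p q) := by
  have h : ∀ l r s : ℕ, ¬(l + r = k + p ∧ l + s = k + q) →
      (lower n ^ l) (single n (k + p) (k + q) F) r s = 0 := by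
    intro l
    induction l with
    | zero => exact fun r s hrs => single_of_ne F (by simpa using hrs)
    | succ l ih =>
      intro r s hrs
      rw [pow_succ', Module.End.mul_apply, lower_apply, ih _ _ (by omega), map_zero]
  funext r s
  by_cases hrs : r = p ∧ s = q
  · obtain ⟨rfl, rfl⟩ := hrs
    rw [single_self]
  · rw [h _ _ _ (by omega), single_of_ne _ hrs]

/-- Multiplication by the `k`-th power of the metric. -/
noncomputable def metricPowMul (n k p q : ℕ) : AltForm n p q →ₗ[ℝ] AltForm n (k + p) (k + q) :=
  LinearMap.proj (k + q) ∘ₗ LinearMap.proj (R := ℝ) (φ := fun p => ∀ q, AltForm n p q) (k + p) ∘ₗ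
    (raise n ^ k) ∘ₗ single n p q

theorem metricPowMul_apply {n k p q : ℕ} (F : AltForm n p q) :
    metricPowMul n k p q F = (raise n ^ k) (single n p q F) (k + p) (k + q) := rfl

/-- The `k`-fold contraction. -/
noncomputable def contractionPow (n k p q : ℕ) : AltForm n (k + p) (k + q) →ₗ[ℝ] AltForm n p q :=
  LinearMap.proj q ∘ₗ LinearMap.proj (R := ℝ) (φ := fun p => ∀ q, AltForm n p q) p ∘ₗ
    (lower n ^ k) ∘ₗ single n (k + p) (k + q)

theorem contractionPow_apply {n k p q : ℕ} (F : AltForm n (k + p) (k + q)) :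
    contractionPow n k p q F = (lower n ^ k) (single n (k + p) (k + q) F) p q := rfl

theorem eq_zero_of_single_eq_zero {n p q : ℕ} {F : AltForm n p q} (h : single n p q F = 0) :
    F = 0 := by
  rw [← single_self F, h]
  rfl

theorem metricPowMul_injective {n k p q : ℕ} (h : k + p + q = n) :
    Function.Injective (metricPowMul n k p q) := by
  refine (injective_iff_map_eq_zero _).2 fun F hF => eq_zero_of_single_eq_zero ?_
  refine sl2_pow_injective (raise n) (lower n) (weight n) lower_raise weight_raise weight_lower
    (n + 1) _ _ k (weight_single F) (lower_pow_eq_zero _) ?_ ?_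
  · rw [← h]
    push_cast
    linarith
  · rw [raise_pow_single, ← metricPowMul_apply, hF, map_zero]

theorem contractionPow_injective {n k p q : ℕ} (h : k + p + q = n) :
    Function.Injective (contractionPow n k p q) := by
  refine (injective_iff_map_eq_zero _).2 fun F hF => eq_zero_of_single_eq_zero ?_
  refine sl2_pow_injective (lower n) (raise n) (-weight n) (fun v => ?_) (fun v => ?_)
    (fun v => ?_) (n + 1) _ (-((n : ℝ) - (k + p : ℕ) - (k + q : ℕ))) k ?_ (raise_pow_eq_zero _)
    ?_ ?_
  · rw [lower_raise]
    simp
  · rw [LinearMap.neg_apply, LinearMap.neg_apply, weight_lower, map_neg]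
    module
  · rw [LinearMap.neg_apply, LinearMap.neg_apply, map_neg, ← weight_raise]
    module
  · rw [LinearMap.neg_apply, weight_single, neg_smul]
  · rw [← h]
    push_cast
    linarith
  · rw [lower_pow_single, ← contractionPow_apply, hF, map_zero]

theorem finite_alternatingMap (M N : Type*) [AddCommGroup M] [Module ℝ M] [Module.Finite ℝ M]
    [AddCommGroup N] [Module ℝ N] [Module.Finite ℝ N] (k : ℕ) :
    Module.Finite ℝ (M [⋀^Fin k]→ₗ[ℝ] N) :=
  Module.Finite.of_injective
    (AlternatingMap.toMultilinearMapLM (S := ℝ) (R := ℝ) (M := M) (N := N) (ι := Fin k))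
    AlternatingMap.coe_multilinearMap_injective

theorem metricPowMul_surjective {n k p q : ℕ} (h : k + p + q = n) :
    Function.Surjective (metricPowMul n k p q) := by
  have := finite_alternatingMap (V n) ℝ q
  have := finite_alternatingMap (V n) (V n [⋀^Fin q]→ₗ[ℝ] ℝ) p
  have hinj : Function.Injective (contractionPow n k p q ∘ₗ metricPowMul n k p q) :=
    (contractionPow_injective h).comp (metricPowMul_injective h)
  intro F
  obtain ⟨G, hG⟩ := LinearMap.injective_iff_surjective.1 hinj (contractionPow n k p q F)
  exact ⟨G, contractionPow_injective h hG⟩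

/-- The antisymmetrization of a raw double form in each of its two groups of arguments. -/
noncomputable def antisymm {n p q : ℕ} (Φ : DF n p q) : DF n p q := fun x y =>
  ∑ σ : Equiv.Perm (Fin p), ∑ ρ : Equiv.Perm (Fin q),
    ((Equiv.Perm.sign σ : ℤ) : ℝ) * ((Equiv.Perm.sign ρ : ℤ) : ℝ) *
      Φ (fun i => x (σ i)) (fun j => y (ρ j))

theorem sign_mul_self {k : ℕ} (τ : Equiv.Perm (Fin k)) :
    ((Equiv.Perm.sign τ : ℤ) : ℝ) * ((Equiv.Perm.sign τ : ℤ) : ℝ) = 1 := by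
  rcases Int.units_eq_one_or (Equiv.Perm.sign τ) with h | h <;> simp [h]

theorem antisymm_comp_perm {n p q : ℕ} (Φ : DF n p q) (τ : Equiv.Perm (Fin p))
    (π : Equiv.Perm (Fin q)) (x : Fin p → V n) (y : Fin q → V n) :
    antisymm (fun u v => Φ (fun i => u (τ i)) (fun j => v (π j))) x y =
      ((Equiv.Perm.sign τ : ℤ) : ℝ) * ((Equiv.Perm.sign π : ℤ) : ℝ) * antisymm Φ x y := by
  simp only [antisymm, Finset.mul_sum]
  refine Fintype.sum_equiv (Equiv.mulRight τ) _ _ fun σ => ?_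
  refine Fintype.sum_equiv (Equiv.mulRight π) _ _ fun ρ => ?_
  simp only [Equiv.coe_mulRight, Equiv.Perm.sign_mul, Units.val_mul, Int.cast_mul,
    Equiv.Perm.mul_apply]
  linear_combination (-((Equiv.Perm.sign σ : ℤ) : ℝ) * ((Equiv.Perm.sign ρ : ℤ) : ℝ) *
    Φ (fun i => x (σ (τ i))) (fun j => y (ρ (π j)))) *
    (sign_mul_self τ * ((Equiv.Perm.sign π : ℤ) : ℝ) * ((Equiv.Perm.sign π : ℤ) : ℝ)
      + sign_mul_self π)

theorem antisymm_sum_comp_perm {n p q : ℕ} {ι κ : Type*} [Fintype ι] [Fintype κ] (Φ : DF n p q)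
    (τ : ι → Equiv.Perm (Fin p)) (π : κ → Equiv.Perm (Fin q)) (c : ℝ)
    (x : Fin p → V n) (y : Fin q → V n) :
    antisymm (fun u v => c * ∑ a, ∑ b, ((Equiv.Perm.sign (τ a) : ℤ) : ℝ) *
        ((Equiv.Perm.sign (π b) : ℤ) : ℝ) * Φ (fun i => u (τ a i)) (fun j => v (π b j))) x y =
      c * (Fintype.card ι * Fintype.card κ) * antisymm Φ x y := by
  have h : ∀ a b, ((Equiv.Perm.sign (τ a) : ℤ) : ℝ) * ((Equiv.Perm.sign (π b) : ℤ) : ℝ) *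
      antisymm (fun u v => Φ (fun i => u (τ a i)) (fun j => v (π b j))) x y =
        antisymm Φ x y := by
    intro a b
    rw [antisymm_comp_perm]
    linear_combination antisymm Φ x y *
      (sign_mul_self (τ a) * ((Equiv.Perm.sign (π b) : ℤ) : ℝ) *
        ((Equiv.Perm.sign (π b) : ℤ) : ℝ) + sign_mul_self (π b))
  calc _ = c * ∑ a, ∑ b, ((Equiv.Perm.sign (τ a) : ℤ) : ℝ) * ((Equiv.Perm.sign (π b) : ℤ) : ℝ) *
        antisymm (fun u v => Φ (fun i => u (τ a i)) (fun j => v (π b j))) x y := by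
        simp only [antisymm, Finset.mul_sum]
        rw [Finset.sum_comm_cycle]
        refine Finset.sum_congr rfl fun a _ => ?_
        rw [Finset.sum_comm_cycle]
        refine Finset.sum_congr rfl fun b _ => Finset.sum_congr rfl fun σ _ =>
          Finset.sum_congr rfl fun ρ _ => ?_
        ring
    _ = _ := by
        simp only [h]
        simp
        ring

theorem antisymm_cast {n p q p' q' : ℕ} (hp : p = p') (hq : q = q') (Φ : DF n p q)
    (x : Fin p' → V n) (y : Fin q' → V n) :
    antisymm Φ (fun i => x (Fin.cast hp i)) (fun j => y (Fin.cast hq j)) =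
      antisymm (fun u v => Φ (fun i => u (Fin.cast hp i)) (fun j => v (Fin.cast hq j))) x y := by
  subst hp hq
  rfl

theorem mul_eq_antisymm {n p q r s : ℕ} (ω : DF n p q) (η : DF n r s)
    (x : Fin (p + r) → V n) (y : Fin (q + s) → V n) :
    mul ω η x y = (((p.factorial * r.factorial * q.factorial * s.factorial : ℕ) : ℝ))⁻¹ *
      antisymm (fun u v => ω (fun i => u (Fin.castAdd r i)) (fun j => v (Fin.castAdd s j)) *
        η (fun i => u (Fin.natAdd p i)) (fun j => v (Fin.natAdd q j))) x y := by
  simp only [mul, antisymm, mul_assoc]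

/-- The permutation of `Fin (a + b)` acting by given permutations on the two blocks. -/
def blockPerm {a b : ℕ} (τ : Equiv.Perm (Fin a)) (π : Equiv.Perm (Fin b)) :
    Equiv.Perm (Fin (a + b)) :=
  finSumFinEquiv.permCongr (Equiv.Perm.sumCongr τ π)

theorem blockPerm_castAdd {a b : ℕ} (τ : Equiv.Perm (Fin a)) (π : Equiv.Perm (Fin b))
    (i : Fin a) : blockPerm τ π (Fin.castAdd b i) = Fin.castAdd b (τ i) := by
  simp [blockPerm, Equiv.permCongr_apply]

theorem blockPerm_natAdd {a b : ℕ} (τ : Equiv.Perm (Fin a)) (π : Equiv.Perm (Fin b))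
    (i : Fin b) : blockPerm τ π (Fin.natAdd a i) = Fin.natAdd a (π i) := by
  simp [blockPerm, Equiv.permCongr_apply]

theorem sign_blockPerm {a b : ℕ} (τ : Equiv.Perm (Fin a)) (π : Equiv.Perm (Fin b)) :
    Equiv.Perm.sign (blockPerm τ π) = Equiv.Perm.sign τ * Equiv.Perm.sign π := by
  rw [blockPerm, Equiv.Perm.sign_permCongr, Equiv.Perm.sign_sumCongr]

theorem gm_mul_mul {n k p q : ℕ} (ω : DF n k k) (η : AltForm n p q)
    (x : Fin (k + 1 + p) → V n) (y : Fin (k + 1 + q) → V n) :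
    mul (mul ω (gm n)) (fun u v => η u v) x y =
      mul ω (fun u v => metricMul n p q η u v) (fun i => x (Fin.cast (by omega) i))
        (fun j => y (Fin.cast (by omega) j)) := by
  rw [mul_eq_antisymm, mul_eq_antisymm]
  have hl := antisymm_sum_comp_perm (fun u v =>
      ω (fun i => u (Fin.castAdd p (Fin.castAdd 1 i)))
          (fun j => v (Fin.castAdd q (Fin.castAdd 1 j))) *
        gm n (fun i => u (Fin.castAdd p (Fin.natAdd k i)))
          (fun j => v (Fin.castAdd q (Fin.natAdd k j))) *
        η (fun i => u (Fin.natAdd (k + 1) i)) (fun j => v (Fin.natAdd (k + 1) j)))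
    (fun σ => blockPerm σ 1) (fun ρ => blockPerm ρ 1)
    (((k.factorial * Nat.factorial 1 * k.factorial * Nat.factorial 1 : ℕ) : ℝ))⁻¹ x y
  have hr := antisymm_sum_comp_perm
      (fun (u : Fin (k + (p + 1)) → V n) (v : Fin (k + (q + 1)) → V n) =>
      ω (fun i => u (Fin.castAdd (p + 1) i)) (fun j => v (Fin.castAdd (q + 1) j)) *
        gm n (fun _ => u (Fin.natAdd k 0)) (fun _ => v (Fin.natAdd k 0)) *
        η (fun i => u (Fin.natAdd k i.succ)) (fun j => v (Fin.natAdd k j.succ)))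
    (fun a : Fin (p + 1) => blockPerm 1 a.cycleRange.symm)
    (fun b : Fin (q + 1) => blockPerm 1 b.cycleRange.symm) 1
    (fun i => x (Fin.cast (by omega) i)) (fun j => y (Fin.cast (by omega) j))
  refine (congrArg _ ((congrFun₂ (congrArg antisymm ?_) x y).trans hl)).trans
    (Eq.trans ?_ (congrArg _ ((congrFun₂ (congrArg antisymm ?_) _ _).trans hr)).symm)
  · funext u v
    simp only [mul_eq_antisymm, antisymm, blockPerm_castAdd, blockPerm_natAdd, sign_blockPerm,
      map_one, mul_one, Equiv.Perm.one_apply, Finset.sum_mul, mul_assoc]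
  · rw [antisymm_cast]
    have hsucc : ∀ {r : ℕ} (i : Fin r) (h : k + (r + 1) = k + 1 + r),
        Fin.cast h (Fin.natAdd k i.succ) = Fin.natAdd (k + 1) i := by
      intro r i h
      ext
      simp
      omega
    have hzero : ∀ {r : ℕ} (h : k + (r + 1) = k + 1 + r),
        Fin.cast h (Fin.natAdd k 0) = Fin.castAdd r (Fin.natAdd k 0) := fun _ => rfl
    have hcast : ∀ {r : ℕ} (i : Fin k) (h : k + (r + 1) = k + 1 + r),
        Fin.cast h (Fin.castAdd (r + 1) i) = Fin.castAdd r (Fin.castAdd 1 i) := fun _ _ => rfl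
    simp only [hsucc, hzero, hcast, gm, Fintype.card_perm, Fintype.card_fin]
    generalize antisymm _ x y = A
    have hk := Nat.factorial_ne_zero k
    have hp := Nat.factorial_ne_zero p
    have hq := Nat.factorial_ne_zero q
    simp only [Nat.factorial_succ, Nat.factorial_zero]
    push_cast
    field_simp
  · funext u v
    have hrem : ∀ {r : ℕ} (a : Fin (r + 1)) (u : Fin (k + (r + 1)) → V n),
        a.removeNth (fun i => u (Fin.natAdd k i)) = fun i => u (Fin.natAdd k (a.succAbove i)) :=
      fun _ _ => rfl
    simp only [metricMul_apply, blockPerm_castAdd, blockPerm_natAdd, sign_blockPerm,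
      map_one, one_mul, Equiv.Perm.one_apply, Equiv.Perm.sign_symm, Fin.sign_cycleRange,
      Fin.cycleRange_symm_zero, Fin.cycleRange_symm_succ, Finset.mul_sum, hrem]
    refine Finset.sum_congr rfl fun a _ => Finset.sum_congr rfl fun b _ => ?_
    push_cast
    simp only [gm, dotProduct]
    ring

theorem altFamily_apply_cast {n p q p' q' : ℕ} (m : AltFamily n) (hp : p = p') (hq : q = q')
    (x : Fin p' → V n) (y : Fin q' → V n) :
    m p q (fun i => x (Fin.cast hp i)) (fun j => y (Fin.cast hq j)) = m p' q' x y := by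
  subst hp hq
  rfl

theorem one_mul_altForm {n p q : ℕ} (m : AltFamily n) (x : Fin (0 + p) → V n)
    (y : Fin (0 + q) → V n) :
    mul (gpow n 0) (fun u v => m p q u v) x y = m (0 + p) (0 + q) x y := by
  have hc : ∀ {r : ℕ} (i : Fin r), Fin.natAdd 0 i = Fin.cast (Nat.zero_add r).symm i :=
    fun i => by ext; simp
  have hm : ∀ (σ : Equiv.Perm (Fin (0 + p))) (ρ : Equiv.Perm (Fin (0 + q))),
      ((Equiv.Perm.sign σ : ℤ) : ℝ) * ((Equiv.Perm.sign ρ : ℤ) : ℝ) *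
        m p q (fun i => x (σ (Fin.natAdd 0 i))) (fun j => y (ρ (Fin.natAdd 0 j))) =
      m (0 + p) (0 + q) x y := by
    intro σ ρ
    simp only [hc]
    rw [altFamily_apply_cast m _ _ (fun i => x (σ i)) (fun j => y (ρ j))]
    have h1 : m (0 + p) (0 + q) (fun i => x (σ i)) = _ := (m (0 + p) (0 + q)).map_perm x σ
    have h2 : m (0 + p) (0 + q) x (fun j => y (ρ j)) = _ := (m (0 + p) (0 + q) x).map_perm y ρ
    rw [h1, Units.smul_def, AlternatingMap.smul_apply, h2, Units.smul_def, zsmul_eq_mul,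
      zsmul_eq_mul]
    linear_combination m (0 + p) (0 + q) x y *
      (sign_mul_self σ * ((Equiv.Perm.sign ρ : ℤ) : ℝ) * ((Equiv.Perm.sign ρ : ℤ) : ℝ) +
        sign_mul_self ρ)
  have hp := Nat.factorial_ne_zero p
  have hq := Nat.factorial_ne_zero q
  simp only [mul, gpow, mul_one, hm, Finset.sum_const, Finset.card_univ, Fintype.card_perm,
    Fintype.card_fin, nsmul_eq_mul, Nat.zero_add, Nat.factorial_zero]
  push_cast
  field_simp

theorem gpow_mul_eq_raise_pow {n : ℕ} (k : ℕ) : ∀ {p q : ℕ} (m : AltFamily n)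
    (x : Fin (k + p) → V n) (y : Fin (k + q) → V n),
    mul (gpow n k) (fun u v => m p q u v) x y = (raise n ^ k) m (k + p) (k + q) x y := by
  induction k with
  | zero => exact fun m x y => one_mul_altForm m x y
  | succ k ih =>
    intro p q m x y
    rw [gpow, gm_mul_mul]
    refine (ih (raise n m) _ _).trans ?_
    rw [altFamily_apply_cast, pow_succ, Module.End.mul_apply]

theorem gpow_mul_eq_metricPowMul {n k p q : ℕ} (F : AltForm n p q) :
    mul (gpow n k) (fun u v => F u v) = fun x y => metricPowMul n k p q F x y := by
  funext x y
  have h := gpow_mul_eq_raise_pow k (single n p q F) x y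
  rwa [single_self] at h

theorem exists_gpow_mul_eq {n k p q r s : ℕ} (h : k + p + q = n) (hr : r = k + p)
    (hs : s = k + q) (θ : DF n r s) (hθ : IsDF θ) :
    ∃ ω : DF n p q, IsDF ω ∧ emb (k + p) (k + q) (mul (gpow n k) ω) = emb r s θ := by
  subst hr hs
  obtain ⟨F, hF⟩ := hθ
  obtain ⟨G, rfl⟩ := metricPowMul_surjective h F
  refine ⟨fun x y => G x y, ⟨G, fun _ _ => rfl⟩, ?_⟩
  rw [gpow_mul_eq_metricPowMul]
  congr 1
  funext x y
  exact (hF x y).symm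

theorem eq_zero_of_gpow_mul_eq_zero {n k p q : ℕ} (h : k + p + q = n) (ω : DF n p q)
    (hω : IsDF ω) (hz : mul (gpow n k) ω = 0) : ω = 0 := by
  obtain ⟨F, hF⟩ := hω
  obtain rfl : ω = fun x y => F x y := funext₂ hF
  rw [gpow_mul_eq_metricPowMul] at hz
  have hF0 : F = 0 := by
    refine metricPowMul_injective h ?_
    rw [map_zero]
    ext x y
    exact congrFun₂ hz x y
  rw [hF0]
  rfl

/-- if `p + q = n`, multiplication by `g^{2i}` is a linear isomorphism
from `D^{p−i,q−i}` onto `D^{p+i,q+i}`. -/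
theorem gpow_even_isomorphism (n p q i : ℕ) (h : p + q = n) (hip : i ≤ p) (hiq : i ≤ q) :
    (∀ ω : DF n (p - i) (q - i), IsDF ω → mul (gpow n (2 * i)) ω = 0 → ω = 0) ∧
    (∀ θ : DF n (p + i) (q + i), IsDF θ →
      ∃ ω : DF n (p - i) (q - i), IsDF ω ∧
        emb ((2 * i) + (p - i)) ((2 * i) + (q - i)) (mul (gpow n (2 * i)) ω)
          = emb (p + i) (q + i) θ) := by
  exact ⟨eq_zero_of_gpow_mul_eq_zero (by omega),
    exists_gpow_mul_eq (by omega) (by omega) (by omega)⟩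

end DoubleForm
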